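/- arXiv:math/0311532 — 2 statements merged into one kernel-verified Lean document; each statement's English description precedes it below -/
import Mathlib

section
/- Let w : ℕ → ℝ be defined by w(0) = 0 and w(k) = 2k(k+3)/((k+1)(k+2)) for k ≥ 1, let d : ℕ → ℝ be defined by d(0) = 0 and d(k) = (3/280)·(k(k+3)/((k+1)(k+2)))·(5k⁴ + 30k³ + 59k² + 42k + 4) for k ≥ 1, and for k ≥ 1 set q(k) = w(k)²·d(k-1)/(12·d(k)) and p(k) = w(k)²·d(k+1)/(12·d(k)). For i ≥ 2 and ℓ ≥ 0 set m(i,ℓ) = ∏_{t=0}^{ℓ-1} q(i+t)/p(i+t) (so m(i,0) = 1). Then, for each k ≥ 1, S(k) := (∑_{ℓ=0}^∞ m(k+1,ℓ))/p(k) is finite, and S(k)/k → 3/7 as k → ∞. -/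
open Filter

/-- `wseq k = W^{(k)}(1/12)`. Note `wseq 0 = 0`. -/
noncomputable def wseq (k : ℕ) : ℝ := 2 * k * (k + 3) / ((k + 1) * (k + 2))

/-- `dseq k` is the limit of `D_N^{(k)}/D_N` as `N → ∞`. Note `dseq 0 = 0`. -/
noncomputable def dseq (k : ℕ) : ℝ :=
  (3 / 280) * ((k : ℝ) * (k + 3) / ((k + 1) * (k + 2))) *
    (5 * (k : ℝ) ^ 4 + 30 * (k : ℝ) ^ 3 + 59 * (k : ℝ) ^ 2 + 42 * k + 4)

/-- probability of a down-step `k → k-1` of the birth and death process. -/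
noncomputable def qseq (k : ℕ) : ℝ := (wseq k) ^ 2 * dseq (k - 1) / (12 * dseq k)

/-- probability of an up-step `k → k+1` of the birth and death process. -/
noncomputable def pseq (k : ℕ) : ℝ := (wseq k) ^ 2 * dseq (k + 1) / (12 * dseq k)

/-- Discrete integral comparison: if the increments of a null sequence `B` are asymptotic to `c * a`
with `c > 0` and `a` eventually positive, then `a` is summable and `B` is asymptotic to `c` times
the tails of `∑ a`. -/
theorem summable_and_tendsto_div_tsum_nat_add {a B : ℕ → ℝ} {c : ℝ} (hc : 0 < c)
    (ha : ∀ᶠ k in atTop, 0 < a k) (hB : Tendsto B atTop (nhds 0))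
    (h : Tendsto (fun k => (B k - B (k + 1)) / a k) atTop (nhds c)) :
    Summable a ∧ Tendsto (fun k => B k / ∑' l, a (k + l)) atTop (nhds c) := by
  have key : ∀ ε : ℝ, 0 < ε → ∀ᶠ k in atTop, ∀ j ≥ k, 0 < a j ∧
      (c - ε) * a j < B j - B (j + 1) ∧ B j - B (j + 1) < (c + ε) * a j := by
    intro ε hε
    refine eventually_forall_ge_atTop.2 ?_
    filter_upwards [ha, h.eventually (Ioo_mem_nhds (sub_lt_self c hε) (lt_add_of_pos_right c hε))]
      with j hj h1
    exact ⟨hj, (lt_div_iff₀ hj).1 h1.1, (div_lt_iff₀ hj).1 h1.2⟩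
  have tele : ∀ᶠ k in atTop, HasSum (fun l => B (k + l) - B (k + (l + 1))) (B k) := by
    filter_upwards [key c hc] with k hk
    rw [hasSum_iff_tendsto_nat_of_nonneg]
    · simp_rw [Finset.sum_range_sub' (fun l => B (k + l))]
      have h0 : Tendsto (fun n => B (k + n)) atTop (nhds 0) :=
        hB.comp (tendsto_atTop_mono (fun n => Nat.le_add_left n k) tendsto_id)
      simpa using h0.const_sub (B k)
    · intro l
      have := (hk (k + l) (Nat.le_add_right k l)).2.1
      rw [sub_self, zero_mul] at this
      exact this.le
  have hs : Summable a := by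
    obtain ⟨k, hk, ht⟩ := ((key (c / 2) (half_pos hc)).and tele).exists
    rw [← summable_nat_add_iff k]
    refine Summable.of_nonneg_of_le (fun l => (hk (l + k) (Nat.le_add_left k l)).1.le)
      (fun l => ?_) (ht.summable.mul_left (2 / c))
    have := (hk (l + k) (Nat.le_add_left k l)).2.1
    rw [div_mul_eq_mul_div, le_div_iff₀ hc, show k + (l + 1) = l + k + 1 by ring, add_comm k l]
    linarith
  refine ⟨hs, ?_⟩
  have hsk : ∀ k, Summable fun l => a (k + l) := fun k => by
    simpa only [add_comm] using (summable_nat_add_iff k).2 hs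
  rw [Metric.tendsto_nhds]
  intro ε hε
  filter_upwards [key (ε / 2) (half_pos hε), tele] with k hk ht
  have hpos : 0 < ∑' l, a (k + l) :=
    (hsk k).tsum_pos (fun l => (hk _ (Nat.le_add_right k l)).1.le) 0
      (hk _ (Nat.le_add_right k 0)).1
  have h1 : (c - ε / 2) * ∑' l, a (k + l) ≤ B k :=
    hasSum_le (fun l => (hk _ (Nat.le_add_right k l)).2.1.le)
      ((hsk k).hasSum.mul_left _) ht
  have h2 : B k ≤ (c + ε / 2) * ∑' l, a (k + l) :=
    hasSum_le (fun l => (hk _ (Nat.le_add_right k l)).2.2.le)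
      ht ((hsk k).hasSum.mul_left _)
  rw [← le_div_iff₀ hpos] at h1
  rw [← div_le_iff₀ hpos] at h2
  rw [Real.dist_eq, abs_lt]
  constructor <;> linarith

theorem dseq_pos {k : ℕ} (hk : 1 ≤ k) : 0 < dseq k := by
  have : (0 : ℝ) < k := by exact_mod_cast hk
  unfold dseq
  positivity

theorem natCast_le_dseq (k : ℕ) : (k : ℝ) ≤ dseq k := by
  rcases Nat.eq_zero_or_pos k with rfl | hk
  · simp [dseq]
  have h1 : (1 : ℝ) ≤ k := by exact_mod_cast hk
  have h2 : (2 / 3 : ℝ) ≤ (k : ℝ) * (k + 3) / ((k + 1) * (k + 2)) := by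
    rw [le_div_iff₀ (by positivity)]
    nlinarith
  have h3 : (140 : ℝ) * k ≤ 5 * (k : ℝ) ^ 4 + 30 * (k : ℝ) ^ 3 + 59 * (k : ℝ) ^ 2 + 42 * k + 4 := by
    obtain ⟨x, hx⟩ : ∃ x : ℝ, (k : ℝ) = 1 + x := ⟨k - 1, by ring⟩
    have hx0 : 0 ≤ x := by linarith
    rw [hx]
    ring_nf
    have := pow_nonneg hx0 2
    have := pow_nonneg hx0 3
    have := pow_nonneg hx0 4
    linarith
  unfold dseq
  calc (k : ℝ) = 3 / 280 * (2 / 3) * (140 * k) := by ring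
    _ ≤ _ := by gcongr

theorem wseq_pos {k : ℕ} (hk : 1 ≤ k) : 0 < wseq k := by
  have : (0 : ℝ) < k := by exact_mod_cast hk
  unfold wseq
  positivity

theorem qseq_div_pseq {k : ℕ} (hk : 1 ≤ k) : qseq k / pseq k = dseq (k - 1) / dseq (k + 1) := by
  have := (wseq_pos hk).ne'
  have := (dseq_pos hk).ne'
  have := (dseq_pos (Nat.le_add_left 1 k)).ne'
  unfold qseq pseq
  field_simp

theorem prod_qseq_div_pseq {k : ℕ} (hk : 1 ≤ k) (l : ℕ) :
    ∏ t ∈ Finset.range l, qseq (k + 1 + t) / pseq (k + 1 + t) =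
      dseq k * dseq (k + 1) * (1 / (dseq (k + l) * dseq (k + l + 1))) := by
  have hd : ∀ j, dseq (k + j) ≠ 0 := fun j => (dseq_pos (by omega)).ne'
  induction l with
  | zero =>
    have := hd 0
    have := hd 1
    simp only [add_zero] at *
    simp
    field_simp
  | succ l ih =>
    rw [Finset.prod_range_succ, ih, qseq_div_pseq (by omega),
      show k + 1 + l - 1 = k + l by omega, show k + 1 + l + 1 = k + (l + 2) by omega,
      show k + (l + 1) + 1 = k + (l + 2) by omega, show k + l + 1 = k + (l + 1) by omega]
    have := hd l
    have := hd (l + 1)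
    have := hd (l + 2)
    field_simp

theorem tendsto_of_eq_comp_natCast_inv {f : ℕ → ℝ} {F : ℝ → ℝ} (hF : ContinuousAt F 0)
    (h : ∀ k : ℕ, 1 ≤ k → f k = F ((k : ℝ)⁻¹)) : Tendsto f atTop (nhds (F 0)) := by
  have h1 : Tendsto (fun k : ℕ => F ((k : ℝ)⁻¹)) atTop (nhds (F 0)) :=
    hF.tendsto.comp tendsto_inv_atTop_nhds_zero_nat
  refine h1.congr' ?_
  filter_upwards [eventually_ge_atTop 1] with k hk
  exact (h k hk).symm

theorem tendsto_pseq : Tendsto pseq atTop (nhds (1 / 3)) := by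
  have h := tendsto_of_eq_comp_natCast_inv (f := pseq)
    (F := fun x => (1 + 4 * x) / (3 * (1 + 2 * x) ^ 2) *
      ((5 * (1 + x) ^ 4 + 30 * x * (1 + x) ^ 3 + 59 * x ^ 2 * (1 + x) ^ 2 + 42 * x ^ 3 * (1 + x)
        + 4 * x ^ 4) / (5 + 30 * x + 59 * x ^ 2 + 42 * x ^ 3 + 4 * x ^ 4)))
    (by refine ContinuousAt.mul ?_ ?_ <;>
        exact ContinuousAt.div (by fun_prop) (by fun_prop) (by norm_num))
    (fun k hk => by
      have : (0 : ℝ) < k := by exact_mod_cast hk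
      unfold pseq wseq dseq
      push_cast
      field_simp
      ring)
  norm_num at h
  exact h

theorem tendsto_sub_mul_dseq_div_dseq :
    Tendsto (fun k : ℕ => (k : ℝ) - (k + 1) * dseq k / dseq (k + 2)) atTop (nhds 7) := by
  have h := tendsto_of_eq_comp_natCast_inv
    (f := fun k : ℕ => (k : ℝ) - (k + 1) * dseq k / dseq (k + 2))
    (F := fun x => (35 + 585 * x + 4007 * x ^ 2 + 14391 * x ^ 3 + 28578 * x ^ 4 + 29772 * x ^ 5
        + 12736 * x ^ 6) /
      ((1 + 2 * x) ^ 2 * (1 + 5 * x) * (5 + 70 * x + 359 * x ^ 2 + 798 * x ^ 3 + 644 * x ^ 4)))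
    (ContinuousAt.div (by fun_prop) (by fun_prop) (by norm_num))
    (fun k hk => by
      have : (0 : ℝ) < k := by exact_mod_cast hk
      unfold dseq
      push_cast
      rw [show 5 * ((k : ℝ) + 2) ^ 4 + 30 * ((k : ℝ) + 2) ^ 3 + 59 * ((k : ℝ) + 2) ^ 2
        + 42 * ((k : ℝ) + 2) + 4 =
        5 * (k : ℝ) ^ 4 + 70 * (k : ℝ) ^ 3 + 359 * (k : ℝ) ^ 2 + 798 * k + 644 by ring]
      field_simp
      ring)
  norm_num at h
  exact h

theorem summable_and_tendsto_div_tsum_dseq :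
    Summable (fun j : ℕ => 1 / (dseq j * dseq (j + 1))) ∧
    Tendsto (fun k : ℕ => (k : ℝ) / (dseq k * dseq (k + 1)) /
      ∑' l : ℕ, 1 / (dseq (k + l) * dseq (k + l + 1))) atTop (nhds 7) := by
  refine summable_and_tendsto_div_tsum_nat_add (a := fun j : ℕ => 1 / (dseq j * dseq (j + 1)))
    (B := fun k : ℕ => (k : ℝ) / (dseq k * dseq (k + 1))) (by norm_num) ?_ ?_ ?_
  · filter_upwards [eventually_ge_atTop 1] with k hk
    have := dseq_pos hk
    have := dseq_pos (Nat.le_add_left 1 k)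
    positivity
  · refine tendsto_of_tendsto_of_tendsto_of_le_of_le' tendsto_const_nhds
      (tendsto_one_div_add_atTop_nhds_zero_nat (𝕜 := ℝ)) ?_ ?_ <;>
    filter_upwards [eventually_ge_atTop 1] with k hk
    all_goals
      have h1 := dseq_pos hk
      have h2 := dseq_pos (Nat.le_add_left 1 k)
    · positivity
    · have h3 := natCast_le_dseq (k + 1)
      push_cast at h3
      rw [div_le_div_iff₀ (by positivity) (by positivity), one_mul]
      exact mul_le_mul (natCast_le_dseq k) h3 (by positivity) h1.le
  · refine tendsto_sub_mul_dseq_div_dseq.congr' ?_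
    filter_upwards [eventually_ge_atTop 1] with k hk
    have := dseq_pos hk
    have := dseq_pos (Nat.le_add_left 1 k)
    have := dseq_pos (k := k + 2) (by omega)
    rw [show k + 1 + 1 = k + 2 by ring]
    push_cast
    field_simp

theorem stmt10 :
    (∀ k : ℕ, 1 ≤ k →
      Summable (fun ℓ : ℕ =>
        ∏ t ∈ Finset.range ℓ, qseq (k + 1 + t) / pseq (k + 1 + t))) ∧
    Tendsto
      (fun k : ℕ =>
        ((∑' ℓ : ℕ, ∏ t ∈ Finset.range ℓ, qseq (k + 1 + t) / pseq (k + 1 + t)) /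
            pseq k) / (k : ℝ))
      atTop (nhds (3 / 7)) := by
  obtain ⟨hs, ht⟩ := summable_and_tendsto_div_tsum_dseq
  refine ⟨fun k hk => ?_, ?_⟩
  · simp_rw [prod_qseq_div_pseq hk]
    refine Summable.mul_left _ ?_
    simpa only [add_comm k] using (summable_nat_add_iff k).2 hs
  · have h := (ht.inv₀ (by norm_num)).div tendsto_pseq (by norm_num)
    rw [show (7 : ℝ)⁻¹ / (1 / 3) = 3 / 7 by norm_num] at h
    refine h.congr' ?_
    filter_upwards [eventually_ge_atTop 1] with k hk
    simp_rw [prod_qseq_div_pseq hk, tsum_mul_left]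
    simp only [Pi.div_apply]
    generalize ∑' l : ℕ, 1 / (dseq (k + l) * dseq (k + l + 1)) = T
    simp only [mul_inv, div_eq_mul_inv, inv_inv]
    ring
end

section
/- Let w : ℕ → ℝ be defined by w(0) = 0 and w(k) = 2k(k+3)/((k+1)(k+2)) for k ≥ 1. A labeled walk from k to j (k, j ≥ 1) is a finite sequence θ = (θ_0, θ_1, …, θ_L) of positive integers, L ≥ 0, with θ_0 = k, θ_L = j and |θ_{t+1} - θ_t| ≤ 1 for 0 ≤ t < L; its weight is 12^{-L}·∏_{t=0}^{L-1} w(θ_t)·w(θ_{t+1}). Define G(k,k) ∈ [0,∞] as the sum of the weights of all labeled walks from k to k. Then there exist constants 0 < c ≤ C such that c·k ≤ G(k,k) ≤ C·k for all integers k ≥ 1; in particular G(k,k) is finite for every k. -/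
open scoped ENNReal

/-- A labeled walk from `k` to `j` of length `L`, encoded as a function
`θ : ℕ → ℕ` with `θ 0 = k`, `θ t = j` for all `t ≥ L` (so in particular
`θ L = j`), consecutive values differing by at most 1 up to time `L`, and all
values positive. -/
def IsLWalk (k j L : ℕ) (θ : ℕ → ℕ) : Prop :=
  θ 0 = k ∧ (∀ t : ℕ, L ≤ t → θ t = j) ∧
    (∀ t : ℕ, t < L → θ (t + 1) ≤ θ t + 1 ∧ θ t ≤ θ (t + 1) + 1) ∧
    (∀ t : ℕ, 1 ≤ θ t)

/-- The type of labeled walks from `k` to `j`: a length together with the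
sequence of labels. -/
def LWalk (k j : ℕ) : Type :=
  { x : ℕ × (ℕ → ℕ) // IsLWalk k j x.1 x.2 }

/-- The weight `12^{-L} ∏_{t<L} w(θ_t) w(θ_{t+1})` of a walk, in `[0,∞]`. -/
noncomputable def walkWeight (L : ℕ) (θ : ℕ → ℕ) : ℝ≥0∞ :=
  (∏ t ∈ Finset.range L, ENNReal.ofReal (wseq (θ t) * wseq (θ (t + 1)))) /
    12 ^ L

/-- `Gfun k j ∈ [0,∞]` is the sum of the weights of all labeled walks from `k`
to `j`.  (For `j = 0` there are no such walks, so `Gfun k 0 = 0`.) -/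
noncomputable def Gfun (k j : ℕ) : ℝ≥0∞ :=
  ∑' x : LWalk k j, walkWeight x.1.1 x.1.2

open Classical in
/-- The sum of the weights of the labeled walks of length `L` from `k` to `j`. -/
noncomputable def walkSum (j L k : ℕ) : ℝ≥0∞ :=
  ∑' θ : ℕ → ℕ, if IsLWalk k j L θ then walkWeight L θ else 0

/-- The weight of a single step between two labels. -/
noncomputable def stepWeight (k l : ℕ) : ℝ≥0∞ :=
  if l ≤ k + 1 ∧ k ≤ l + 1 then ENNReal.ofReal (wseq k * wseq l / 12) else 0

/-- Splitting off the first term of a sequence. -/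
def consEquiv : ℕ × (ℕ → ℕ) ≃ (ℕ → ℕ) where
  toFun x := fun n => Nat.casesOn n x.1 x.2
  invFun θ := (θ 0, fun n => θ (n + 1))
  left_inv _ := rfl
  right_inv θ := by
    funext n
    cases n <;> rfl

lemma wseq_nonneg (n : ℕ) : 0 ≤ wseq n := by
  unfold wseq; positivity

lemma wseq_eq (n : ℕ) : wseq n = 2 * (1 - 2 / (((n : ℝ) + 1) * (n + 2))) := by
  unfold wseq; field_simp; ring

lemma wseq_le_two (n : ℕ) : wseq n ≤ 2 := by
  have : 0 ≤ 2 / (((n : ℝ) + 1) * (n + 2)) := by positivity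
  rw [wseq_eq]; linarith

lemma wseq_mul_nonneg (k l : ℕ) : 0 ≤ wseq k * wseq l / 12 := by
  have := mul_nonneg (wseq_nonneg k) (wseq_nonneg l)
  positivity

lemma wseq_mul_le (k l : ℕ) : wseq k * wseq l / 12 ≤ 1 / 3 := by
  have := mul_le_mul (wseq_le_two k) (wseq_le_two l) (wseq_nonneg l) (by norm_num)
  linarith

lemma stepWeight_zero (l : ℕ) : stepWeight 0 l = 0 := by
  simp [stepWeight, wseq]

lemma Gfun_eq_tsum (k j : ℕ) : Gfun k j = ∑' L, walkSum j L k := by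
  classical
  unfold Gfun LWalk walkSum
  refine (tsum_subtype {x : ℕ × (ℕ → ℕ) | IsLWalk k j x.1 x.2}
    (fun x => walkWeight x.1 x.2)).trans ?_
  rw [ENNReal.tsum_prod']
  simp only [Set.indicator, Set.mem_ofPred_eq]

lemma walkSum_zero (j k : ℕ) (hj : 1 ≤ j) :
    walkSum j 0 k = if k = j then 1 else 0 := by
  classical
  unfold walkSum
  rw [tsum_eq_single (fun _ => j)]
  · simp only [IsLWalk, walkWeight]
    by_cases h : k = j <;> simp [h, hj, eq_comm (a := j)]
  · intro θ hθ
    rw [if_neg]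
    rintro ⟨-, h, -⟩
    exact hθ (funext fun t => h t (Nat.zero_le t))

lemma isLWalk_cons {k j L a : ℕ} {θ : ℕ → ℕ} :
    IsLWalk k j (L + 1) (consEquiv (a, θ)) ↔
      a = k ∧ 1 ≤ k ∧ (θ 0 ≤ k + 1 ∧ k ≤ θ 0 + 1) ∧ IsLWalk (θ 0) j L θ := by
  constructor
  · rintro ⟨h0, h1, h2, h3⟩
    have h0' : a = k := h0
    subst h0'
    exact ⟨rfl, h3 0, h2 0 (by omega), rfl, fun t ht => h1 (t + 1) (by omega),
      fun t ht => h2 (t + 1) (by omega), fun t => h3 (t + 1)⟩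
  · rintro ⟨rfl, hk, hs, -, h1, h2, h3⟩
    refine ⟨rfl, ?_, ?_, ?_⟩
    · rintro (_ | t) ht
      · omega
      · exact h1 t (by omega)
    · rintro (_ | t) ht
      · exact hs
      · exact h2 t (by omega)
    · rintro (_ | t)
      · exact hk
      · exact h3 t

lemma walkWeight_cons (L a : ℕ) (θ : ℕ → ℕ) :
    walkWeight (L + 1) (consEquiv (a, θ)) =
      ENNReal.ofReal (wseq a * wseq (θ 0) / 12) * walkWeight L θ := by
  unfold walkWeight
  rw [Finset.prod_range_succ']
  change (∏ t ∈ Finset.range L, ENNReal.ofReal (wseq (θ t) * wseq (θ (t + 1)))) *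
    ENNReal.ofReal (wseq a * wseq (θ 0)) / 12 ^ (L + 1) = _
  rw [ENNReal.ofReal_div_of_pos (by norm_num), pow_succ]
  simp only [div_eq_mul_inv]
  rw [ENNReal.mul_inv (by simp) (by simp)]
  norm_num
  ring

lemma walkSum_succ (j L k : ℕ) :
    walkSum j (L + 1) k = ∑' l, stepWeight k l * walkSum j L l := by
  classical
  have key : ∀ (a : ℕ) (θ : ℕ → ℕ),
      (if IsLWalk k j (L + 1) (consEquiv (a, θ)) then
        walkWeight (L + 1) (consEquiv (a, θ)) else 0) =
      if a = k then stepWeight k (θ 0) *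
        (if IsLWalk (θ 0) j L θ then walkWeight L θ else 0) else 0 := by
    intro a θ
    rw [walkWeight_cons]
    simp only [isLWalk_cons]
    by_cases ha : a = k
    · subst ha
      rcases Nat.eq_zero_or_pos a with rfl | hk
      · simp [stepWeight_zero]
      · by_cases hs : θ 0 ≤ a + 1 ∧ a ≤ θ 0 + 1 <;>
        by_cases hw : IsLWalk (θ 0) j L θ <;>
        simp [hs, hw, stepWeight, Nat.succ_le_of_lt hk]
    · simp [ha]
  unfold walkSum
  rw [← consEquiv.tsum_eq, ENNReal.tsum_prod']
  simp only [key]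
  rw [tsum_eq_single k (by intro a ha; simp [ha])]
  simp only [if_true, ← ENNReal.tsum_mul_left]
  rw [ENNReal.tsum_comm]
  refine tsum_congr fun θ => ?_
  rw [tsum_eq_single (θ 0)]
  intro l hl
  rw [if_neg, mul_zero]
  rintro ⟨h, -⟩
  exact hl h.symm

lemma sum_walkSum_succ (j N k : ℕ) :
    ∑ L ∈ Finset.range (N + 1), walkSum j L k =
      walkSum j 0 k + ∑' l, stepWeight k l * ∑ L ∈ Finset.range N, walkSum j L l := by
  rw [Finset.sum_range_succ', add_comm]
  simp only [walkSum_succ, Finset.mul_sum]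
  rw [Summable.tsum_finsetSum (fun _ _ => ENNReal.summable)]

lemma tsum_stepWeight (i : ℕ) (g : ℕ → ℝ≥0∞) :
    ∑' l, stepWeight (i + 1) l * g l =
      ENNReal.ofReal (wseq (i + 1) * wseq i / 12) * g i +
      ENNReal.ofReal (wseq (i + 1) * wseq (i + 1) / 12) * g (i + 1) +
      ENNReal.ofReal (wseq (i + 1) * wseq (i + 2) / 12) * g (i + 2) := by
  rw [tsum_eq_sum (s := {i, i + 1, i + 2})]
  · rw [Finset.sum_insert (by simp), Finset.sum_insert (by simp), Finset.sum_singleton]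
    simp [stepWeight, add_assoc]
  · intro l hl
    simp only [Finset.mem_insert, Finset.mem_singleton, not_or] at hl
    rw [stepWeight, if_neg (by omega), zero_mul]

lemma tsum_stepWeight_ofReal (i : ℕ) {h : ℕ → ℝ} (hh : ∀ n, 0 ≤ h n) :
    ∑' l, stepWeight (i + 1) l * ENNReal.ofReal (h l) =
      ENNReal.ofReal (wseq (i + 1) * wseq i / 12 * h i +
        wseq (i + 1) * wseq (i + 1) / 12 * h (i + 1) +
        wseq (i + 1) * wseq (i + 2) / 12 * h (i + 2)) := by
  have h0 (l n : ℕ) : 0 ≤ wseq (i + 1) * wseq l / 12 * h n :=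
    mul_nonneg (wseq_mul_nonneg _ _) (hh n)
  rw [tsum_stepWeight, ENNReal.ofReal_add (add_nonneg (h0 _ _) (h0 _ _)) (h0 _ _),
    ENNReal.ofReal_add (h0 _ _) (h0 _ _)]
  simp only [ENNReal.ofReal_mul (wseq_mul_nonneg _ _)]

lemma tsum_stepWeight_le_one (k : ℕ) : ∑' l, stepWeight k l ≤ 1 := by
  rcases k with _ | i
  · simp [stepWeight_zero]
  · have := tsum_stepWeight_ofReal i (h := fun _ => 1) (fun _ => zero_le_one)
    simp only [ENNReal.ofReal_one, mul_one] at this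
    rw [this, ← ENNReal.ofReal_one]
    apply ENNReal.ofReal_le_ofReal
    linarith [wseq_mul_le (i + 1) i, wseq_mul_le (i + 1) (i + 1), wseq_mul_le (i + 1) (i + 2)]

/-- Comparison with a supersolution. -/
lemma Gfun_le_of_supersolution {j : ℕ} {h : ℕ → ℝ≥0∞}
    (hh : ∀ n, walkSum j 0 n + ∑' l, stepWeight n l * h l ≤ h n) (k : ℕ) :
    Gfun k j ≤ h k := by
  rw [Gfun_eq_tsum]
  refine ENNReal.tsum_le_of_sum_range_le fun N => ?_
  induction N generalizing k with
  | zero => simp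
  | succ N ih =>
    rw [sum_walkSum_succ]
    refine le_trans ?_ (hh k)
    gcongr with l
    exact ih l

/-- Comparison with a bounded strict subsolution. -/
lemma le_Gfun_of_subsolution {j : ℕ} {f : ℕ → ℝ≥0∞} {M r : ℝ≥0∞} (hM : M ≠ ⊤) (hr : r < 1)
    (hfM : ∀ n, f n ≤ M)
    (hf : ∀ n, f n ≤ walkSum j 0 n + r * ∑' l, stepWeight n l * f l) (k : ℕ) :
    f k ≤ Gfun k j := by
  have key : ∀ N k, f k ≤ ∑ L ∈ Finset.range N, walkSum j L k + r ^ N * M := by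
    intro N
    induction N with
    | zero => simpa using hfM
    | succ N ih =>
      intro k
      rw [sum_walkSum_succ, add_assoc]
      refine (hf k).trans ?_
      gcongr
      calc r * ∑' l, stepWeight k l * f l
          ≤ r * ∑' l, stepWeight k l *
              (∑ L ∈ Finset.range N, walkSum j L l + r ^ N * M) := by
            gcongr with l; exact ih l
        _ = r * ∑' l, stepWeight k l * ∑ L ∈ Finset.range N, walkSum j L l +
              r * ((∑' l, stepWeight k l) * (r ^ N * M)) := by
            simp only [mul_add]
            rw [ENNReal.tsum_add, ENNReal.tsum_mul_right, mul_add]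
        _ ≤ 1 * ∑' l, stepWeight k l * ∑ L ∈ Finset.range N, walkSum j L l +
              r * (1 * (r ^ N * M)) := by
            gcongr
            exact tsum_stepWeight_le_one k
        _ = _ := by ring
  have hlim : Filter.Tendsto (fun N => Gfun k j + r ^ N * M) Filter.atTop
      (nhds (Gfun k j + 0 * M)) :=
    tendsto_const_nhds.add (ENNReal.Tendsto.mul_const
      (ENNReal.tendsto_pow_atTop_nhds_zero_of_lt_one hr) (Or.inr hM))
  rw [zero_mul, add_zero] at hlim
  refine ge_of_tendsto' hlim fun N => (key N k).trans ?_
  gcongr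
  rw [Gfun_eq_tsum]
  exact ENNReal.sum_le_tsum _

lemma Gfun_self_le (k : ℕ) (hk : 1 ≤ k) : Gfun k k ≤ ENNReal.ofReal (3 * k) := by
  have := Gfun_le_of_supersolution (j := k)
    (h := fun n => ENNReal.ofReal (3 * (min n k : ℕ))) (fun n => ?_) k
  · simpa using this
  rw [walkSum_zero k n hk]
  rcases n with _ | i
  · simp [stepWeight_zero, show 0 ≠ k by omega]
  · rw [tsum_stepWeight_ofReal i (h := fun n => 3 * (min n k : ℕ)) (fun n => by positivity)]
    have b (l n : ℕ) : wseq (i + 1) * wseq l / 12 * (3 * (n : ℝ)) ≤ 1 / 3 * (3 * n) :=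
      mul_le_mul_of_nonneg_right (wseq_mul_le _ _) (by positivity)
    have b0 := b i (min i k)
    have b1 := b (i + 1) (min (i + 1) k)
    have b2 := b (i + 2) (min (i + 2) k)
    have hz (l n : ℕ) : 0 ≤ wseq (i + 1) * wseq l / 12 * (3 * (n : ℝ)) :=
      mul_nonneg (wseq_mul_nonneg _ _) (by positivity)
    have hd : (if i + 1 = k then 1 else 0 : ℝ≥0∞) =
        ENNReal.ofReal ((if i + 1 = k then 1 else 0 : ℕ) : ℝ) := by
      split_ifs <;> simp
    rw [hd, ← ENNReal.ofReal_add (by positivity)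
      (add_nonneg (add_nonneg (hz _ _) (hz _ _)) (hz _ _))]
    apply ENNReal.ofReal_le_ofReal
    have hnat : (if i + 1 = k then 1 else 0 : ℕ) + min i k + min (i + 2) k
        ≤ 2 * min (i + 1) k := by
      split_ifs <;> omega
    have hreal : ((if i + 1 = k then 1 else 0 : ℕ) : ℝ) + (min i k : ℕ) + (min (i + 2) k : ℕ)
        ≤ 2 * (min (i + 1) k : ℕ) := by exact_mod_cast hnat
    linarith

lemma one_le_Gfun_self (k : ℕ) (hk : 1 ≤ k) : 1 ≤ Gfun k k := by
  rw [Gfun_eq_tsum]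
  refine le_trans ?_ (ENNReal.le_tsum 0)
  simp [walkSum_zero k k hk]

lemma le_wseq {i k n : ℕ} (hk : 8 ≤ k) (hi : 7 * k ≤ 8 * (i + 1)) (hn : i ≤ n) :
    2 * (1 - 3 / (k : ℝ) ^ 2) ≤ wseq n := by
  rw [wseq_eq]
  have h1 : (7 : ℝ) * k ≤ 8 * (n + 1) := by
    have : 7 * k ≤ 8 * (n + 1) := by omega
    exact_mod_cast this
  have hk' : (8 : ℝ) ≤ k := by exact_mod_cast hk
  have : 2 / (((n : ℝ) + 1) * (n + 2)) ≤ 3 / (k : ℝ) ^ 2 := by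
    rw [div_le_div_iff₀ (by positivity) (by positivity)]
    nlinarith
  linarith

lemma le_wseq_mul {i k n : ℕ} (hk : 8 ≤ k) (hi : 7 * k ≤ 8 * (i + 1)) (hn : i ≤ n) :
    (1 - 7 / (k : ℝ) ^ 2) / 3 ≤ (1 - 1 / (k : ℝ) ^ 2) * (wseq (i + 1) * wseq n / 12) := by
  have hk' : (8 : ℝ) ≤ k := by exact_mod_cast hk
  have hx : 1 / (k : ℝ) ^ 2 ≤ 1 / 64 := by
    apply one_div_le_one_div_of_le <;> nlinarith
  have hx0 : 0 < 1 / (k : ℝ) ^ 2 := by positivity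
  have h1 := le_wseq hk hi hn
  have h2 := le_wseq hk hi (Nat.le_succ i)
  rw [show 3 / (k : ℝ) ^ 2 = 3 * (1 / (k : ℝ) ^ 2) by ring] at h1 h2
  rw [show 7 / (k : ℝ) ^ 2 = 7 * (1 / (k : ℝ) ^ 2) by ring]
  generalize 1 / (k : ℝ) ^ 2 = x at *
  have h3 := mul_le_mul h2 h1 (by linarith) (wseq_nonneg _)
  have h4 := mul_le_mul_of_nonneg_left h3 (show 0 ≤ 1 - x by linarith)
  simp only [Nat.succ_eq_add_one] at h4
  nlinarith [mul_nonneg hx0.le (mul_nonneg hx0.le (show (0:ℝ) ≤ 15 - 9 * x by linarith))]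

/-- A bump of height and width of order `k` centred at `k`. -/
noncomputable def bump (k n : ℕ) : ℝ := ((k / 8 - (n - k) - (k - n) : ℕ) : ℝ) ^ 2 / k

lemma bump_nonneg (k n : ℕ) : 0 ≤ bump k n := by
  unfold bump; positivity

lemma bump_subsolution {k i : ℕ} (hk : 8 ≤ k) (hi : i + 1 < k + k / 8) (hi' : k < i + 1 + k / 8) :
    bump k (i + 1) ≤ (if i + 1 = k then 1 else 0) +
      (1 - 7 / (k : ℝ) ^ 2) / 3 * (bump k i + bump k (i + 1) + bump k (i + 2)) := by
  have hk' : (8 : ℝ) ≤ k := by exact_mod_cast hk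
  have hx : 7 / (k : ℝ) ^ 2 ≤ 7 / 64 := by
    apply div_le_div_of_nonneg_left <;> nlinarith
  have hx0 : 0 < 7 / (k : ℝ) ^ 2 := by positivity
  obtain ⟨s, hs⟩ : ∃ s, k / 8 - (i + 1 - k) - (k - (i + 1)) = s + 1 :=
    ⟨k / 8 - (i + 1 - k) - (k - (i + 1)) - 1, by omega⟩
  have hsk : 8 * ((s : ℝ) + 1) ≤ k := by
    have : 8 * (s + 1) ≤ k := by omega
    exact_mod_cast this
  have hq : 7 / (k : ℝ) ^ 2 * ((s : ℝ) + 1) ^ 2 ≤ 7 / 64 := by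
    rw [div_mul_eq_mul_div, div_le_div_iff₀ (by positivity) (by norm_num)]
    nlinarith [mul_self_le_mul_self (by positivity) hsk]
  unfold bump
  rw [hs]
  generalize 7 / (k : ℝ) ^ 2 = q at *
  by_cases hik : i + 1 = k
  · have e0 : k / 8 - (i - k) - (k - i) = s := by omega
    have e2 : k / 8 - (i + 2 - k) - (k - (i + 2)) = s := by omega
    rw [e0, e2, if_pos hik]
    push_cast
    have hrw : (1 : ℝ) + (1 - q) / 3 * ((s : ℝ) ^ 2 / k + ((s : ℝ) + 1) ^ 2 / k + (s : ℝ) ^ 2 / k)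
        = (k + (1 - q) / 3 * (2 * (s : ℝ) ^ 2 + ((s : ℝ) + 1) ^ 2)) / k := by
      field_simp
      ring
    rw [hrw]
    gcongr
    nlinarith [mul_nonneg hx0.le (Nat.cast_nonneg (α := ℝ) s)]
  · have e : (k / 8 - (i - k) - (k - i) = s ∧ k / 8 - (i + 2 - k) - (k - (i + 2)) = s + 2) ∨
        (k / 8 - (i - k) - (k - i) = s + 2 ∧ k / 8 - (i + 2 - k) - (k - (i + 2)) = s) := by
      omega
    have main : ((s : ℝ) + 1) ^ 2 / k ≤
        (1 - q) / 3 * ((s : ℝ) ^ 2 / k + ((s : ℝ) + 1) ^ 2 / k + ((s : ℝ) + 2) ^ 2 / k) := by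
      rw [← add_div, ← add_div, ← mul_div_assoc]
      gcongr
      nlinarith
    rw [if_neg hik, zero_add]
    rcases e with ⟨e0, e2⟩ | ⟨e0, e2⟩
    · rw [e0, e2]; push_cast; exact main
    · rw [e0, e2]; push_cast; linarith [main]

lemma ofReal_bump_le_Gfun {k : ℕ} (hk : 8 ≤ k) (n : ℕ) :
    ENNReal.ofReal (bump k n) ≤ Gfun n k := by
  have hk' : (8 : ℝ) ≤ k := by exact_mod_cast hk
  have hx : 1 / (k : ℝ) ^ 2 ≤ 1 / 64 := by
    apply one_div_le_one_div_of_le <;> nlinarith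
  have hx0 : 0 < 1 / (k : ℝ) ^ 2 := by positivity
  refine le_Gfun_of_subsolution (f := fun n => ENNReal.ofReal (bump k n))
    (M := ENNReal.ofReal ((k : ℝ) ^ 2 / k)) (r := ENNReal.ofReal (1 - 1 / (k : ℝ) ^ 2))
    ENNReal.ofReal_ne_top ?_ (fun n => ?_) (fun n => ?_) n
  · rw [ENNReal.ofReal_lt_one]; linarith
  · apply ENNReal.ofReal_le_ofReal
    unfold bump
    gcongr
    omega
  · by_cases hn : n < k + k / 8 ∧ k < n + k / 8
    · obtain ⟨i, rfl⟩ : ∃ i, n = i + 1 := ⟨n - 1, by omega⟩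
      rw [walkSum_zero k _ (by omega), tsum_stepWeight_ofReal i (bump_nonneg k),
        ← ENNReal.ofReal_mul (by linarith)]
      have hd : (if i + 1 = k then 1 else 0 : ℝ≥0∞) =
          ENNReal.ofReal (if i + 1 = k then 1 else 0 : ℝ) := by
        split_ifs <;> simp
      have hz (l n : ℕ) : 0 ≤ wseq (i + 1) * wseq l / 12 * bump k n :=
        mul_nonneg (wseq_mul_nonneg _ _) (bump_nonneg k n)
      rw [hd, ← ENNReal.ofReal_add (by split_ifs <;> norm_num) (mul_nonneg (by linarith)
        (add_nonneg (add_nonneg (hz _ _) (hz _ _)) (hz _ _)))]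
      apply ENNReal.ofReal_le_ofReal
      refine (bump_subsolution hk hn.1 hn.2).trans ?_
      have hi : 7 * k ≤ 8 * (i + 1) := by omega
      have b0 := mul_le_mul_of_nonneg_right (le_wseq_mul hk hi le_rfl) (bump_nonneg k i)
      have b1 := mul_le_mul_of_nonneg_right (le_wseq_mul hk hi (n := i + 1) (by omega))
        (bump_nonneg k (i + 1))
      have b2 := mul_le_mul_of_nonneg_right (le_wseq_mul hk hi (n := i + 2) (by omega))
        (bump_nonneg k (i + 2))
      linarith
    · have : k / 8 - (n - k) - (k - n) = 0 := by omega
      simp [bump, this]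

lemma le_Gfun_self (k : ℕ) (hk : 1 ≤ k) : ENNReal.ofReal (1 / 256 * k) ≤ Gfun k k := by
  by_cases h8 : 8 ≤ k
  · refine le_trans (ENNReal.ofReal_le_ofReal ?_) (ofReal_bump_le_Gfun h8 k)
    have hm : (k : ℝ) ≤ 16 * (k / 8 : ℕ) := by
      have : k ≤ 16 * (k / 8) := by omega
      exact_mod_cast this
    have hk' : (8 : ℝ) ≤ k := by exact_mod_cast h8
    unfold bump
    rw [Nat.sub_self, Nat.sub_zero, Nat.sub_zero, le_div_iff₀ (by linarith)]
    nlinarith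
  · refine le_trans ?_ (one_le_Gfun_self k hk)
    rw [ENNReal.ofReal_le_one]
    have : (k : ℝ) ≤ 8 := by exact_mod_cast (by omega : k ≤ 8)
    linarith

theorem stmt14 :
    ∃ c C : ℝ, 0 < c ∧ c ≤ C ∧
      ∀ k : ℕ, 1 ≤ k →
        ENNReal.ofReal (c * (k : ℝ)) ≤ Gfun k k ∧
        Gfun k k ≤ ENNReal.ofReal (C * (k : ℝ)) := by
  refine ⟨1 / 256, 3, by norm_num, by norm_num, fun k hk => ⟨le_Gfun_self k hk, Gfun_self_le k hk⟩⟩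
end
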